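/- arXiv:1606.08894 — 2 statements merged into one kernel-verified Lean document; each statement's English description precedes it below -/
import Mathlib

section
/- Let R be a commutative domain and v an additive valuation on R. Assume there exists a nonzero f ∈ R with 1 ≤ v(f) < ∞. Then v(a_m(v)) ≥ m for every integer m ≥ 1, the sequence m ↦ v(a_m(v))/m converges to 1 as m → ∞, and consequently inf_{m ≥ 1} v(a_m(v))/m = 1. -/
open scoped ENNReal

/-- An additive valuation on a commutative domain `R`: a function `v : R → [0,∞]` with
`v 0 = ∞`, `v 1 = 0`, `v (f*g) = v f + v g`, and `v (f+g) ≥ min (v f) (v g)`. -/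
structure AdditiveValuation (R : Type*) [CommRing R] [IsDomain R] where
  toFun : R → ℝ≥0∞
  map_zero' : toFun 0 = ⊤
  map_one' : toFun 1 = 0
  map_mul' : ∀ f g : R, toFun (f * g) = toFun f + toFun g
  map_add' : ∀ f g : R, min (toFun f) (toFun g) ≤ toFun (f + g)

namespace AdditiveValuation

variable {R : Type*} [CommRing R] [IsDomain R]

/-- The value `v(𝔞) = inf { v f : f ∈ 𝔞, f ≠ 0 }` of an ideal along an additive valuation. -/
noncomputable def idealVal (v : AdditiveValuation R) (I : Ideal R) : ℝ≥0∞ :=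
  ⨅ f ∈ {g : R | g ∈ I ∧ g ≠ 0}, v.toFun f

/-- The valuation ideal `𝔞_m(v) = { f ∈ R : v f ≥ m }`. -/
def valIdeal (v : AdditiveValuation R) (m : ℕ) : Ideal R where
  carrier := {f : R | (m : ℝ≥0∞) ≤ v.toFun f}
  zero_mem' := by simp [v.map_zero']
  add_mem' := fun {a b} ha hb => le_trans (le_min ha hb) (v.map_add' a b)
  smul_mem' := fun c f hf => by
    simpa only [smul_eq_mul, Set.mem_setOf_eq, v.map_mul' c f] using le_trans hf le_add_self

end AdditiveValuation

namespace AdditiveValuation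

variable {R : Type*} [CommRing R] [IsDomain R]

theorem toFun_pow (v : AdditiveValuation R) (f : R) (k : ℕ) :
    v.toFun (f ^ k) = k * v.toFun f := by
  induction k with
  | zero => simp [v.map_one']
  | succ k ih => rw [pow_succ, v.map_mul', ih]; push_cast; ring

theorem le_idealVal_valIdeal (v : AdditiveValuation R) (m : ℕ) :
    (m : ℝ≥0∞) ≤ v.idealVal (v.valIdeal m) :=
  le_iInf₂ fun _ hf => hf.1

theorem idealVal_le (v : AdditiveValuation R) {I : Ideal R} {f : R} (hf : f ∈ I) (hf0 : f ≠ 0) :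
    v.idealVal I ≤ v.toFun f :=
  iInf₂_le f ⟨hf, hf0⟩

/-- A nonzero element of positive finite value `v f` bounds the excess of `v(𝔞_m(v))` over `m`. -/
theorem idealVal_valIdeal_le_add (v : AdditiveValuation R) {f : R} (hf0 : f ≠ 0)
    (hpos : v.toFun f ≠ 0) (hfin : v.toFun f ≠ ⊤) (m : ℕ) :
    v.idealVal (v.valIdeal m) ≤ m + v.toFun f := by
  obtain ⟨a, ha⟩ : ∃ a : NNReal, (a : ℝ≥0∞) = v.toFun f := ⟨_, ENNReal.coe_toNNReal hfin⟩
  have ha0 : 0 < a := by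
    rw [← ha] at hpos
    exact pos_iff_ne_zero.mpr (by exact_mod_cast hpos)
  set k := ⌈(m : NNReal) / a⌉₊
  have hlow : (m : NNReal) ≤ k * a := (div_le_iff₀ ha0).mp (Nat.le_ceil _)
  have hup : k * a ≤ m + a := by
    calc k * a ≤ (m / a + 1) * a := by
          gcongr
          exact (Nat.ceil_lt_add_one zero_le).le
      _ = m + a := by rw [add_mul, one_mul, div_mul_cancel₀ _ ha0.ne']
  have hval : v.toFun (f ^ k) = ((k * a : NNReal) : ℝ≥0∞) := by
    rw [v.toFun_pow, ← ha]; push_cast; rfl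
  have hmem : f ^ k ∈ v.valIdeal m := by
    change (m : ℝ≥0∞) ≤ v.toFun (f ^ k)
    rw [hval]; exact_mod_cast hlow
  refine (v.idealVal_le hmem (pow_ne_zero k hf0)).trans ?_
  rw [hval, ← ha]; exact_mod_cast hup

end AdditiveValuation

/-- **Lemma (v(𝔞_•(v)) = 1).** If `v` is an additive valuation on a commutative domain `R`
admitting a nonzero element `f` with `1 ≤ v f < ∞`, then `v(𝔞_m(v)) ≥ m` for every `m ≥ 1`,
the sequence `m ↦ v(𝔞_m(v))/m` converges to `1`, and `inf_{m ≥ 1} v(𝔞_m(v))/m = 1`. -/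
theorem valuation_of_own_valuation_ideals_eq_one
    {R : Type*} [CommRing R] [IsDomain R] (v : AdditiveValuation R)
    (hex : ∃ f : R, f ≠ 0 ∧ 1 ≤ v.toFun f ∧ v.toFun f < ⊤) :
    (∀ m : ℕ, 1 ≤ m → (m : ℝ≥0∞) ≤ v.idealVal (v.valIdeal m)) ∧
    Filter.Tendsto (fun m : ℕ => v.idealVal (v.valIdeal m) / (m : ℝ≥0∞))
      Filter.atTop (nhds 1) ∧
    (⨅ m ∈ Set.Ici (1 : ℕ), v.idealVal (v.valIdeal m) / (m : ℝ≥0∞)) = 1 := by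
  obtain ⟨f, hf0, hf1, hfin⟩ := hex
  have hpos : v.toFun f ≠ 0 := (zero_lt_one.trans_le hf1).ne'
  have hone : ∀ m : ℕ, 1 ≤ m → 1 ≤ v.idealVal (v.valIdeal m) / (m : ℝ≥0∞) := fun m hm => by
    rw [ENNReal.le_div_iff_mul_le (Or.inl (by exact_mod_cast (by omega : m ≠ 0)))
      (Or.inl (ENNReal.natCast_ne_top m)), one_mul]
    exact v.le_idealVal_valIdeal m
  have htendsto : Filter.Tendsto (fun m : ℕ => v.idealVal (v.valIdeal m) / (m : ℝ≥0∞))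
      Filter.atTop (nhds 1) := by
    have hbound : Filter.Tendsto (fun m : ℕ => 1 + v.toFun f / (m : ℝ≥0∞))
        Filter.atTop (nhds 1) := by
      simpa using (tendsto_const_nhds (x := (1 : ℝ≥0∞))).add
        (ENNReal.Tendsto.const_div ENNReal.tendsto_nat_nhds_top (Or.inr hfin.ne))
    refine tendsto_of_tendsto_of_tendsto_of_le_of_le' tendsto_const_nhds hbound ?_ ?_
    · filter_upwards [Filter.eventually_ge_atTop 1] with m hm using hone m hm
    · filter_upwards [Filter.eventually_ge_atTop 1] with m hm
      have hm0 : (m : ℝ≥0∞) ≠ 0 := by exact_mod_cast (by omega : m ≠ 0)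
      rw [← ENNReal.div_self hm0 (ENNReal.natCast_ne_top m), ← ENNReal.add_div]
      exact ENNReal.div_le_div_right (v.idealVal_valIdeal_le_add hf0 hpos hfin.ne m) _
  refine ⟨fun m _ => v.le_idealVal_valIdeal m, htendsto, le_antisymm ?_ (le_iInf₂ hone)⟩
  refine ge_of_tendsto htendsto ?_
  filter_upwards [Filter.eventually_ge_atTop 1] with m hm using iInf₂_le m hm
end

section
/- Let k be an uncountable algebraically closed field and A a nonzero finitely generated k-algebra that is an integral domain. If (Z_d)_{d ∈ ℕ} is a countable family of closed subsets of Spec A with Z_d ≠ Spec A for every d, then there exists a closed point of Spec A not lying in the union ⋃_{d ∈ ℕ} Z_d. -/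
/-- Countably many nonzero polynomials in finitely many variables over an uncountable domain
have a common point of nonvanishing. -/
theorem MvPolynomial.exists_forall_eval_ne_zero_of_countable {R ι : Type*} [CommRing R]
    [IsDomain R] [Uncountable R] [Countable ι] {n : ℕ} (p : ι → MvPolynomial (Fin n) R)
    (hp : ∀ i, p i ≠ 0) : ∃ x : Fin n → R, ∀ i, eval x (p i) ≠ 0 := by
  induction n with
  | zero =>
    refine ⟨Fin.elim0, fun i h ↦ hp i ?_⟩
    obtain ⟨c, hc⟩ := C_surjective (R := R) (Fin 0) (p i)
    rw [← hc, eval_C] at h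
    rw [← hc, h, C_0]
  | succ n ih =>
    have hq (i : ι) : finSuccEquiv R n (p i) ≠ 0 := by simpa using hp i
    obtain ⟨x, hx⟩ := ih (fun i ↦ (finSuccEquiv R n (p i)).leadingCoeff)
      fun i ↦ Polynomial.leadingCoeff_ne_zero.mpr (hq i)
    have hmap (i : ι) : (finSuccEquiv R n (p i)).map (eval x) ≠ 0 := fun h ↦ hx i <| by
      simpa using congrArg (Polynomial.coeff · (finSuccEquiv R n (p i)).natDegree) h
    have hcount : (⋃ i, {y | ((finSuccEquiv R n (p i)).map (eval x)).IsRoot y}).Countable :=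
      Set.countable_iUnion fun i ↦ (Polynomial.finite_setOfPred_isRoot (hmap i)).countable
    obtain ⟨y, hy⟩ := (Set.ne_univ_iff_exists_notMem _).mp fun h ↦
      Set.not_countable_univ (h.subst (motive := Set.Countable) hcount)
    refine ⟨Fin.cons y x, fun i h ↦ hy (Set.mem_iUnion.mpr ⟨i, ?_⟩)⟩
    rwa [eval_eq_eval_mv_eval'] at h

/-- A proper closed subset of the spectrum of a domain lies in the vanishing locus of a single
nonzero element. -/
theorem PrimeSpectrum.exists_ne_zero_subset_zeroLocus_singleton {A : Type*} [CommRing A]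
    [IsDomain A] {Z : Set (PrimeSpectrum A)} (hZ : IsClosed Z) (hne : Z ≠ Set.univ) :
    ∃ f : A, f ≠ 0 ∧ Z ⊆ zeroLocus {f} := by
  obtain ⟨s, rfl⟩ := (isClosed_iff_zeroLocus Z).mp hZ
  by_contra! h
  refine hne (Set.eq_univ_of_forall fun x f hf ↦ ?_)
  by_cases hf0 : f = 0
  · simp [hf0]
  · exact absurd (zeroLocus_anti_mono (Set.singleton_subset_iff.mpr hf)) (h f hf0)

/-- **A variety over an uncountable field is not covered by countably many proper closed
subsets, even on closed points.** If `A` is a nonzero finitely generated domain over an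
uncountable algebraically closed field `k` and `(Z_d)_{d ∈ ℕ}` are proper closed subsets of
`Spec A`, then some closed point of `Spec A` avoids `⋃_d Z_d`. -/
theorem exists_closed_point_not_mem_iUnion_of_proper_closed
    {k A : Type*} [Field k] [IsAlgClosed k] [Uncountable k]
    [CommRing A] [IsDomain A] [Algebra k A] [Algebra.FiniteType k A]
    (Z : ℕ → Set (PrimeSpectrum A))
    (hclosed : ∀ d, IsClosed (Z d))
    (hproper : ∀ d, Z d ≠ Set.univ) :
    ∃ x : PrimeSpectrum A, IsClosed ({x} : Set (PrimeSpectrum A)) ∧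
      x ∉ ⋃ d : ℕ, Z d := by
  choose f hf hZ using fun d ↦
    PrimeSpectrum.exists_ne_zero_subset_zeroLocus_singleton (hclosed d) (hproper d)
  obtain ⟨n, φ, hinj, hint⟩ := exists_integral_inj_algHom_of_fg k A
  algebraize [φ.toRingHom]
  have hcomap (d : ℕ) : ∃ g : MvPolynomial (Fin n) k, g ≠ 0 ∧
      algebraMap _ A g ∈ Ideal.span {f d} := by
    obtain ⟨g, hg, hg0⟩ := Submodule.exists_mem_ne_zero_of_ne_bot
      (Ideal.comap_ne_bot_of_integral_mem (R := MvPolynomial (Fin n) k) (hf d)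
        (Ideal.mem_span_singleton_self (f d)) (Algebra.IsIntegral.isIntegral (f d)))
    exact ⟨g, hg0, hg⟩
  choose g hg0 hg using hcomap
  obtain ⟨x, hx⟩ := MvPolynomial.exists_forall_eval_ne_zero_of_countable g hg0
  have hmax : (RingHom.ker (MvPolynomial.eval x)).IsMaximal :=
    RingHom.ker_isMaximal_of_surjective _ fun c ↦ ⟨MvPolynomial.C c, MvPolynomial.eval_C c⟩
  obtain ⟨Q, hQ, hQx⟩ := Ideal.exists_ideal_over_maximal_of_isIntegral (S := A)
    (RingHom.ker (MvPolynomial.eval x))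
    (((RingHom.injective_iff_ker_eq_bot (algebraMap (MvPolynomial (Fin n) k) A)).mp hinj).trans_le
      bot_le)
  refine ⟨⟨Q, hQ.isPrime⟩, (PrimeSpectrum.isClosed_singleton_iff_isMaximal _).mpr hQ, ?_⟩
  rw [Set.mem_iUnion]
  rintro ⟨d, hd⟩
  have hfQ : Ideal.span {f d} ≤ Q := by
    simpa [Ideal.span_le] using hZ d hd
  have hgx : g d ∈ RingHom.ker (MvPolynomial.eval x) := hQx ▸ Ideal.mem_comap.mpr (hfQ (hg d))
  exact hx d hgx
end
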